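/- arXiv:1504.05170 — 3 statements merged into one kernel-verified Lean document; each statement's English description precedes it below -/
import Mathlib

section
/- Let m_sc be the Stieltjes transform of the semicircle law and ρ_sc the semicircle density. For every E ∈ ℝ and every η with 0 < η ≤ 1, one has |(1/π)·Im m_sc(E + iη) − ρ_sc(E)| ≤ 2·√η. -/
/-- The semicircle density `ρ_sc(x) = (1/(2π))·√(max(4 − x², 0))`. -/
noncomputable def rhoSC (x : ℝ) : ℝ := (1 / (2 * Real.pi)) * Real.sqrt (max (4 - x ^ 2) 0)

/-- The Stieltjes transform of the semicircle law, `m_sc(z) = ∫ ρ_sc(x)/(x − z) dx`. -/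
noncomputable def mSC (z : ℂ) : ℂ := ∫ x : ℝ, (rhoSC x : ℂ) / ((x : ℂ) - z)

open MeasureTheory Set in
theorem integral_Ioi_add_rpow {a η : ℝ} (ha : a < -1) (hη : 0 < η) :
    ∫ t in Ioi (0 : ℝ), (t + η) ^ a = -η ^ (a + 1) / (a + 1) := by
  have h := (measurePreserving_add_right volume η).setIntegral_preimage_emb
    (measurableEmbedding_addRight η) (fun t : ℝ => t ^ a) (Ioi η)
  rw [integral_Ioi_rpow_of_lt ha hη] at h
  simpa using h

open MeasureTheory in
theorem integral_abs_add_rpow {η : ℝ} (hη : 0 < η) :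
    ∫ t : ℝ, (|t| + η) ^ (-(3 / 2) : ℝ) = 4 / Real.sqrt η := by
  rw [integral_comp_abs (f := fun t => (t + η) ^ (-(3 / 2) : ℝ)),
    integral_Ioi_add_rpow (by norm_num) hη, show (-(3 / 2) + 1 : ℝ) = -(1 / 2) by norm_num,
    Real.rpow_neg hη.le, ← Real.sqrt_eq_rpow]
  ring

theorem abs_sqrt_sub_sqrt_le {a b : ℝ} (ha : 0 ≤ a) (hb : 0 ≤ b) :
    |Real.sqrt a - Real.sqrt b| ≤ Real.sqrt |a - b| := by
  apply Real.le_sqrt_of_sq_le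
  have h1 := Real.sq_sqrt ha
  have h2 := Real.sq_sqrt hb
  have h3 := Real.sqrt_nonneg a
  have h4 := Real.sqrt_nonneg b
  rw [sq_abs]
  rcases le_total b a with h | h
  · have := Real.sqrt_le_sqrt h
    rw [abs_of_nonneg (by linarith)]
    nlinarith
  · have := Real.sqrt_le_sqrt h
    rw [abs_of_nonpos (by linarith)]
    nlinarith

theorem abs_max_four_sub_sq_sub_le (x y : ℝ) :
    |max (4 - x ^ 2) 0 - max (4 - y ^ 2) 0| ≤ 4 * |x - y| := by
  wlog h : x ^ 2 ≤ y ^ 2 generalizing x y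
  · rw [abs_sub_comm, abs_sub_comm x y]
    exact this y x (le_of_not_ge h)
  have hxy : |y| ≤ |x| + |x - y| := by
    have := abs_sub_abs_le_abs_sub y x
    rw [abs_sub_comm] at this
    linarith
  have h0 := abs_nonneg (x - y)
  have hx := abs_nonneg x
  have hle : |x| ≤ |y| := sq_le_sq.mp h
  rw [← sq_abs x, ← sq_abs y]
  rw [abs_of_nonneg (sub_nonneg.2 (max_le_max_right _ (by nlinarith)))]
  rcases le_total |y| 2 with hy | hy
  · rw [max_eq_left (by nlinarith), max_eq_left (by nlinarith)]
    nlinarith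
  · rw [max_eq_right (a := 4 - |y| ^ 2) (by nlinarith), sub_zero]
    apply max_le _ (by linarith)
    rcases le_total |x| 2 with hx2 | hx2 <;> nlinarith

/-- The semicircle density is `1/2`-Hölder continuous. -/
theorem abs_rhoSC_sub_le (x y : ℝ) :
    |rhoSC x - rhoSC y| ≤ 1 / Real.pi * Real.sqrt |x - y| := by
  have hπ := Real.pi_pos
  have h := (abs_sqrt_sub_sqrt_le (le_max_right (4 - x ^ 2) 0) (le_max_right (4 - y ^ 2) 0)).trans
    (Real.sqrt_le_sqrt (abs_max_four_sub_sq_sub_le x y))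
  rw [Real.sqrt_mul (by norm_num), show (4 : ℝ) = 2 ^ 2 by norm_num,
    Real.sqrt_sq (by norm_num)] at h
  unfold rhoSC
  rw [← mul_sub, abs_mul, abs_of_pos (by positivity)]
  calc _ ≤ 1 / (2 * Real.pi) * (2 * Real.sqrt |x - y|) := by
        gcongr
        norm_num at h ⊢
        exact h
    _ = _ := by field_simp

theorem continuous_rhoSC : Continuous rhoSC := by
  unfold rhoSC
  fun_prop

theorem rhoSC_eq_zero {x : ℝ} (hx : x ∉ Set.Icc (-2 : ℝ) 2) : rhoSC x = 0 := by
  have : 4 - x ^ 2 ≤ 0 := by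
    by_contra! h
    exact hx ⟨by nlinarith, by nlinarith⟩
  simp [rhoSC, max_eq_right this]

open MeasureTheory in
theorem integrable_rhoSC_div {z : ℂ} (hz : z.im ≠ 0) :
    Integrable fun x : ℝ => (rhoSC x : ℂ) / ((x : ℂ) - z) := by
  apply Continuous.integrable_of_hasCompactSupport
  · refine (Complex.continuous_ofReal.comp continuous_rhoSC).div (by fun_prop) fun x h => hz ?_
    simpa using congrArg Complex.im h
  · exact HasCompactSupport.intro (isCompact_Icc (a := (-2 : ℝ)) (b := 2))
      fun x hx => by simp [rhoSC_eq_zero hx]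

open ProbabilityTheory in
theorem im_rhoSC_div (E x : ℝ) (γ : NNReal) :
    ((rhoSC x : ℂ) / ((x : ℂ) - (E + ((γ : ℝ) : ℂ) * Complex.I))).im
      = Real.pi * (rhoSC x * cauchyPDFReal E γ x) := by
  have hπ := Real.pi_ne_zero
  rw [cauchyPDFReal_def, Complex.div_im]
  simp only [Complex.normSq_apply, Complex.ofReal_re, Complex.ofReal_im, Complex.sub_re,
    Complex.sub_im, Complex.add_re, Complex.add_im, Complex.mul_re, Complex.mul_im,
    Complex.I_re, Complex.I_im]
  field_simp
  ring_nf

open ProbabilityTheory in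
theorem sqrt_abs_mul_cauchyPDFReal_le (E x : ℝ) {γ : NNReal} (hγ : 0 < γ) :
    Real.sqrt |x - E| * cauchyPDFReal E γ x
      ≤ 2 * γ / Real.pi * (|x - E| + γ) ^ (-(3 / 2) : ℝ) := by
  have hπ := Real.pi_pos
  have hη : (0 : ℝ) < γ := hγ
  rw [cauchyPDFReal_def, ← sq_abs (x - E)]
  have ht := abs_nonneg (x - E)
  generalize |x - E| = t at ht ⊢
  have hs : 0 < t + γ := by positivity
  have e : (t + γ) ^ (-(3 / 2) : ℝ) = Real.sqrt (t + γ) * ((t + γ) ^ 2)⁻¹ := by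
    rw [Real.sqrt_eq_rpow, ← Real.rpow_natCast, ← Real.rpow_neg hs.le, ← Real.rpow_add hs]
    norm_num
  have h1 : Real.sqrt t ≤ Real.sqrt (t + γ) := Real.sqrt_le_sqrt (by linarith)
  have h2 : (t ^ 2 + (γ : ℝ) ^ 2)⁻¹ ≤ 2 * ((t + γ) ^ 2)⁻¹ := by
    rw [← div_eq_mul_inv, inv_eq_one_div, div_le_div_iff₀ (by positivity) (by positivity)]
    nlinarith [sq_nonneg (t - γ)]
  rw [e]
  calc _ ≤ Real.sqrt (t + γ) * (Real.pi⁻¹ * γ * (2 * ((t + γ) ^ 2)⁻¹)) := by gcongr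
    _ = _ := by ring

/-- **Estimate (3.20).** For every `E ∈ ℝ` and `0 < η ≤ 1`,
`|(1/π)·Im m_sc(E + iη) − ρ_sc(E)| ≤ 2·√η`. -/
theorem stmt4 (E η : ℝ) (hη : 0 < η) (hη' : η ≤ 1) :
    |(1 / Real.pi) * (mSC ((E : ℂ) + (η : ℂ) * Complex.I)).im - rhoSC E|
      ≤ 2 * Real.sqrt η := by
  have hπ := Real.pi_pos
  lift η to NNReal using hη.le
  have hγ : 0 < η := hη
  let P := ProbabilityTheory.cauchyPDFReal E η
  have hP1 : ∫ x, P x = 1 := ProbabilityTheory.integral_cauchyPDFReal_eq_one E hγ.ne'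
  have hPi : MeasureTheory.Integrable P := ProbabilityTheory.integrable_cauchyPDFReal E
  have hP0 (x : ℝ) : 0 ≤ P x := (ProbabilityTheory.cauchyPDF_pos E hγ.ne' x).le
  have hint := integrable_rhoSC_div
    (z := (E : ℂ) + ((η : ℝ) : ℂ) * Complex.I) (by simpa using hγ.ne')
  have him : (mSC ((E : ℂ) + ((η : ℝ) : ℂ) * Complex.I)).im
      = Real.pi * ∫ x, rhoSC x * P x := by
    rw [mSC, ← MeasureTheory.integral_const_mul]
    refine (integral_im hint).symm.trans ?_
    exact MeasureTheory.integral_congr_ae (.of_forall fun x => im_rhoSC_div E x η)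
  have hρP : MeasureTheory.Integrable fun x => rhoSC x * P x := by
    refine (hint.im.const_mul Real.pi⁻¹).congr (.of_forall fun x => ?_)
    refine (congrArg (Real.pi⁻¹ * ·) (im_rhoSC_div E x η)).trans ?_
    exact inv_mul_cancel_left₀ hπ.ne' _
  have hdiff : (1 / Real.pi) * (mSC ((E : ℂ) + ((η : ℝ) : ℂ) * Complex.I)).im - rhoSC E
      = ∫ x, (rhoSC x - rhoSC E) * P x := by
    simp_rw [sub_mul]
    rw [him, MeasureTheory.integral_sub hρP (hPi.const_mul _),
      MeasureTheory.integral_const_mul, hP1]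
    field_simp
  have hG : ∫ x : ℝ, (|x - E| + (η : ℝ)) ^ (-(3 / 2) : ℝ) = 4 / Real.sqrt η :=
    (MeasureTheory.integral_sub_right_eq_self
      (fun t : ℝ => (|t| + (η : ℝ)) ^ (-(3 / 2) : ℝ)) E).trans (integral_abs_add_rpow hη)
  have hsq : 0 < Real.sqrt η := Real.sqrt_pos.2 hη
  have hGi : MeasureTheory.Integrable fun x : ℝ => (|x - E| + (η : ℝ)) ^ (-(3 / 2) : ℝ) := by
    by_contra h
    rw [MeasureTheory.integral_undef h] at hG
    exact (by positivity : 4 / Real.sqrt η ≠ 0) hG.symm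
  rw [hdiff, ← Real.norm_eq_abs]
  calc ‖∫ x, (rhoSC x - rhoSC E) * P x‖
      ≤ ∫ x, 1 / Real.pi * (2 * η / Real.pi * (|x - E| + (η : ℝ)) ^ (-(3 / 2) : ℝ)) := by
        refine MeasureTheory.norm_integral_le_of_norm_le ((hGi.const_mul _).const_mul _)
          (.of_forall fun x => ?_)
        rw [norm_mul, Real.norm_eq_abs, Real.norm_of_nonneg (hP0 x)]
        calc _ ≤ 1 / Real.pi * Real.sqrt |x - E| * P x :=
              mul_le_mul_of_nonneg_right (abs_rhoSC_sub_le x E) (hP0 x)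
          _ ≤ _ := by
              rw [mul_assoc]
              exact mul_le_mul_of_nonneg_left (sqrt_abs_mul_cauchyPDFReal_le E x hγ)
                (by positivity)
    _ = 8 / Real.pi ^ 2 * (η / Real.sqrt η) := by
        rw [MeasureTheory.integral_const_mul, MeasureTheory.integral_const_mul, hG]
        ring
    _ ≤ 2 * Real.sqrt η := by
        rw [Real.div_sqrt]
        gcongr
        rw [div_le_iff₀ (by positivity)]
        nlinarith [Real.pi_gt_three]
end

section
/- Let N ≥ 2 be an integer, let δ > 0, τ > 0 and C ≥ 1, and let λ_1, …, λ_N ∈ ℝ satisfy the (δ, C)-non-accumulation property. Fix an index i and assume |λ_j − λ_i| ≥ N^{−1−τ} for all j ≠ i. Then there exists a constant C' > 0 depending only on C and δ (but not on N, i, τ or the λ_j) such that Σ_{j ≠ i} 1/|λ_j − λ_i| ≤ C'·N^{1+τ+δ}. -/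
/-- The `(δ, C)`-non-accumulation property: every interval `I` of length `|I| ≥ N^{−1+δ}`
contains at most `C·|I|·N` of the points `λ_j`. -/
def NonAccum (N : ℕ) (δ C : ℝ) (lam : Fin N → ℝ) : Prop :=
  ∀ a b : ℝ, a ≤ b → (N : ℝ) ^ (-1 + δ) ≤ b - a →
    ((Finset.univ.filter (fun j => a ≤ lam j ∧ lam j ≤ b)).card : ℝ) ≤ C * (b - a) * N

theorem one_div_le_dyadic_sum {r A d : ℝ} (hr : 0 < r) (hd : 0 < d) (hA : 1 / d ≤ A) (K : ℕ) :
    1 / d ≤ (if d ≤ r then A else 0)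
      + ∑ k ∈ Finset.range K, (if d ≤ 2 ^ (k + 1) * r then 1 / (2 ^ k * r) else 0)
      + 1 / (2 ^ K * r) := by
  have hA0 : 0 ≤ A := (one_div_pos.2 hd).le.trans hA
  have hpos (n : ℕ) : 0 < (2 : ℝ) ^ n * r := by positivity
  have hif : 0 ≤ if d ≤ r then A else 0 := by split_ifs <;> linarith
  induction K with
  | zero =>
    split_ifs with h
    · have := one_div_pos.2 hr
      simp only [Finset.range_zero, Finset.sum_empty, pow_zero, one_mul]
      linarith
    · simpa using one_div_le_one_div_of_le hr (not_le.1 h).le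
  | succ K ih =>
    rw [Finset.sum_range_succ]
    have hlast := one_div_pos.2 (hpos (K + 1))
    by_cases h : d ≤ 2 ^ (K + 1) * r
    · rw [if_pos h]
      linarith
    · have h1 := one_div_le_one_div_of_le (hpos (K + 1)) (not_le.1 h).le
      have h2 : 0 ≤ ∑ k ∈ Finset.range K,
          (if d ≤ 2 ^ (k + 1) * r then 1 / (2 ^ k * r) else 0) :=
        Finset.sum_nonneg fun k _ => by
          split_ifs
          · exact (one_div_pos.2 (hpos k)).le
          · exact le_rfl
      rw [if_neg h]
      linarith

theorem NonAccum.card_le {N : ℕ} {δ C : ℝ} {lam : Fin N → ℝ} (h : NonAccum N δ C lam)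
    (i : Fin N) {s : ℝ} (hs : (N : ℝ) ^ (-1 + δ) ≤ s) :
    (((Finset.univ.filter (· ≠ i)).filter fun j => |lam j - lam i| ≤ s).card : ℝ)
      ≤ C * (2 * s) * N := by
  have hs0 : 0 ≤ s := (Real.rpow_nonneg N.cast_nonneg _).trans hs
  refine le_trans ?_ ((h (lam i - s) (lam i + s) (by linarith) (by linarith)).trans_eq (by ring))
  refine Nat.cast_le.2 (Finset.card_le_card fun j hj => ?_)
  have hj' := abs_le.1 (Finset.mem_filter.1 hj).2
  exact Finset.mem_filter.2 ⟨Finset.mem_univ j, by linarith [hj'.1], by linarith [hj'.2]⟩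

theorem natLog_two_add_one_le {N : ℕ} (hN : 2 ≤ N) {δ : ℝ} (hδ : 0 < δ) :
    ((Nat.log 2 N + 1 : ℕ) : ℝ) ≤ 2 / (δ * Real.log 2) * (N : ℝ) ^ δ := by
  have hN2 : (2 : ℝ) ≤ N := by exact_mod_cast hN
  have hl2 : 0 < Real.log 2 := Real.log_pos one_lt_two
  have h1 : (Nat.log 2 N : ℝ) * Real.log 2 ≤ Real.log N := by
    rw [← Real.log_pow]
    refine Real.log_le_log (by positivity) ?_
    exact_mod_cast Nat.pow_log_le_self 2 (by omega)
  have h2 : Real.log 2 ≤ Real.log N := Real.log_le_log two_pos hN2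
  have h3 : Real.log N ≤ (N : ℝ) ^ δ / δ := Real.log_le_rpow_div N.cast_nonneg hδ
  have h4 : ((Nat.log 2 N + 1 : ℕ) : ℝ) * Real.log 2 ≤ 2 * ((N : ℝ) ^ δ / δ) := by
    push_cast
    linarith
  calc ((Nat.log 2 N + 1 : ℕ) : ℝ) ≤ 2 * ((N : ℝ) ^ δ / δ) / Real.log 2 := (le_div_iff₀ hl2).2 h4
    _ = 2 / (δ * Real.log 2) * (N : ℝ) ^ δ := by field_simp

/-- **Dyadic decomposition estimate (4.12).** Under `(δ, C)`-non-accumulation and a lower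
bound `|λ_j − λ_i| ≥ N^{−1−τ}` for all `j ≠ i`, one has
`∑_{j ≠ i} 1/|λ_j − λ_i| ≤ C'·N^{1+τ+δ}` with `C'` depending only on `C` and `δ`. -/
theorem stmt6 (δ C : ℝ) (hδ : 0 < δ) (hC : 1 ≤ C) :
    ∃ C' : ℝ, 0 < C' ∧
      ∀ N : ℕ, 2 ≤ N → ∀ τ : ℝ, 0 < τ →
      ∀ lam : Fin N → ℝ, NonAccum N δ C lam →
      ∀ i : Fin N, (∀ j : Fin N, j ≠ i → (N : ℝ) ^ (-1 - τ) ≤ |lam j - lam i|) →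
        ∑ j ∈ Finset.univ.filter (· ≠ i), 1 / |lam j - lam i|
          ≤ C' * (N : ℝ) ^ (1 + τ + δ) := by
  have hl2 : 0 < Real.log 2 := Real.log_pos one_lt_two
  refine ⟨2 * C + 4 * C * (2 / (δ * Real.log 2)) + 1, by positivity, ?_⟩
  intro N hN τ hτ lam hlam i hsep
  have hN1 : (1 : ℝ) ≤ N := by exact_mod_cast (by omega : 1 ≤ N)
  have hN0 : (0 : ℝ) < N := by linarith
  set r : ℝ := (N : ℝ) ^ (-1 + δ) with hr_def
  set A : ℝ := (N : ℝ) ^ (1 + τ) with hA_def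
  set K : ℕ := Nat.log 2 N + 1 with hK_def
  set S := Finset.univ.filter (fun j : Fin N => j ≠ i)
  have hr : 0 < r := Real.rpow_pos_of_pos hN0 _
  have hA : 0 < A := Real.rpow_pos_of_pos hN0 _
  have hrN : r * N = (N : ℝ) ^ δ := by
    rw [hr_def, ← Real.rpow_add_one hN0.ne']
    congr 1
    ring
  have hpt : ∀ j ∈ S, 1 / |lam j - lam i| ≤ (if |lam j - lam i| ≤ r then A else 0)
      + ∑ k ∈ Finset.range K, (if |lam j - lam i| ≤ 2 ^ (k + 1) * r then 1 / (2 ^ k * r) else 0)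
      + 1 / (2 ^ K * r) := by
    intro j hj
    have hp : 0 < (N : ℝ) ^ (-1 - τ) := Real.rpow_pos_of_pos hN0 _
    have hd := hsep j (Finset.mem_filter.1 hj).2
    refine one_div_le_dyadic_sum hr (hp.trans_le hd) ((one_div_le_one_div_of_le hp hd).trans_eq ?_) K
    rw [one_div, ← Real.rpow_neg hN0.le, hA_def]
    congr 1
    ring
  have hnear : ∑ j ∈ S, (if |lam j - lam i| ≤ r then A else 0)
      ≤ 2 * C * (N : ℝ) ^ (1 + τ + δ) := by
    rw [← Finset.sum_filter, Finset.sum_const, nsmul_eq_mul]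
    calc _ ≤ C * (2 * r) * N * A := mul_le_mul_of_nonneg_right (hlam.card_le i le_rfl) hA.le
      _ = 2 * C * (A * (r * N)) := by ring
      _ = _ := by rw [hrN, Real.rpow_add hN0 (1 + τ) δ]
  have hshell (k : ℕ) :
      ∑ j ∈ S, (if |lam j - lam i| ≤ 2 ^ (k + 1) * r then 1 / (2 ^ k * r) else 0)
        ≤ 4 * C * N := by
    rw [← Finset.sum_filter, Finset.sum_const, nsmul_eq_mul]
    have hle : r ≤ 2 ^ (k + 1) * r := le_mul_of_one_le_left hr.le (one_le_pow₀ one_le_two)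
    calc _ ≤ C * (2 * (2 ^ (k + 1) * r)) * N * (1 / (2 ^ k * r)) :=
          mul_le_mul_of_nonneg_right (hlam.card_le i hle) (by positivity)
      _ = 4 * C * N := by field_simp; ring
  have htail : ∑ _j ∈ S, 1 / (2 ^ K * r) ≤ (N : ℝ) := by
    have hNK : (N : ℝ) ≤ 2 ^ K := by
      exact_mod_cast (Nat.lt_pow_succ_log_self one_lt_two N).le
    have hone : 1 ≤ 2 ^ K * r := calc
      (1 : ℝ) ≤ (N : ℝ) ^ δ := Real.one_le_rpow hN1 hδ.le
      _ = N * r := by rw [← hrN, mul_comm]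
      _ ≤ 2 ^ K * r := mul_le_mul_of_nonneg_right hNK hr.le
    have hcard : (S.card : ℝ) ≤ N := by
      exact_mod_cast S.card_le_univ.trans_eq (Fintype.card_fin N)
    rw [Finset.sum_const, nsmul_eq_mul]
    calc _ ≤ (S.card : ℝ) * 1 := by
          gcongr
          exact (div_le_one (by positivity)).2 hone
      _ ≤ N := by rwa [mul_one]
  have hmid : 4 * C * N * K ≤ 4 * C * (2 / (δ * Real.log 2)) * (N : ℝ) ^ (1 + τ + δ) := by
    calc 4 * C * N * K ≤ 4 * C * N * (2 / (δ * Real.log 2) * (N : ℝ) ^ δ) := by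
          gcongr
          exact natLog_two_add_one_le hN hδ
      _ = 4 * C * (2 / (δ * Real.log 2)) * (N : ℝ) ^ (1 + δ) := by
          rw [Real.rpow_add hN0, Real.rpow_one]
          ring
      _ ≤ _ := by
          gcongr
          linarith
  have hN_le : (N : ℝ) ≤ (N : ℝ) ^ (1 + τ + δ) :=
    Real.self_le_rpow_of_one_le hN1 (by linarith)
  calc _ ≤ _ := Finset.sum_le_sum hpt
    _ = ∑ j ∈ S, (if |lam j - lam i| ≤ r then A else 0)
        + ∑ k ∈ Finset.range K,
          ∑ j ∈ S, (if |lam j - lam i| ≤ 2 ^ (k + 1) * r then 1 / (2 ^ k * r) else 0)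
        + ∑ _j ∈ S, 1 / (2 ^ K * r) := by
        rw [Finset.sum_add_distrib, Finset.sum_add_distrib, Finset.sum_comm]
    _ ≤ 2 * C * (N : ℝ) ^ (1 + τ + δ) + 4 * C * N * K + N := by
        refine add_le_add (add_le_add hnear ?_) htail
        refine (Finset.sum_le_sum fun k _ => hshell k).trans_eq ?_
        rw [Finset.sum_const, nsmul_eq_mul, Finset.card_range, mul_comm]
    _ ≤ _ := by linarith
end

section
/- Let N ≥ 2 be an integer, let δ > 0 and C ≥ 1, and let λ_1, …, λ_N ∈ ℝ satisfy the (δ, C)-non-accumulation property. Then there exists a constant C' > 0 depending only on C and δ such that for every E ∈ ℝ and every η ≥ N^{−1−δ}, Σ_{i=1}^N 1/|λ_i − E − iη| ≤ C'·N^{1+2δ}, where |λ_i − E − iη| = ((λ_i − E)² + η²)^{1/2}. -/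
/-- The resolvent modulus is at most its inverse distance to the spectral parameter. -/
theorem one_div_sqrt_le_of_le_abs {x η d : ℝ} (hd : 0 < d) (h : d ≤ |x|) :
    1 / Real.sqrt (x ^ 2 + η ^ 2) ≤ 1 / d := by
  refine one_div_le_one_div_of_le hd (h.trans ?_)
  rw [← Real.sqrt_sq_eq_abs]
  exact Real.sqrt_le_sqrt (by nlinarith [sq_nonneg η])

/-- The resolvent modulus is at most the inverse of the imaginary part. -/
theorem one_div_sqrt_le_one_div {x η : ℝ} (hη : 0 < η) :
    1 / Real.sqrt (x ^ 2 + η ^ 2) ≤ 1 / η := by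
  refine one_div_le_one_div_of_le hη ?_
  exact Real.le_sqrt_of_sq_le (by nlinarith [sq_nonneg x])

/-- Pointwise dyadic majorant of the resolvent modulus, at dyadic scales starting from `r`. -/
theorem one_div_sqrt_le_dyadic {x η r : ℝ} (hη : 0 < η) (hr : 0 < r) (K : ℕ) :
    1 / Real.sqrt (x ^ 2 + η ^ 2) ≤
      (if |x| ≤ r then 1 / η else 0)
        + ∑ k ∈ Finset.range K, (if |x| ≤ 2 ^ (k + 1) * r then 1 / (2 ^ k * r) else 0)
        + 1 / (2 ^ K * r) := by
  have hsum : ∀ K : ℕ, 0 ≤ ∑ k ∈ Finset.range K,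
      (if |x| ≤ 2 ^ (k + 1) * r then 1 / (2 ^ k * r) else 0) := fun K =>
    Finset.sum_nonneg fun k _ => by split_ifs <;> positivity
  have hfirst : 0 ≤ (if |x| ≤ r then 1 / η else 0) := by split_ifs <;> positivity
  induction K with
  | zero =>
    by_cases h : |x| ≤ r
    · have := one_div_sqrt_le_one_div (x := x) hη
      have : 0 < 1 / r := by positivity
      simp only [h, if_true, Finset.range_zero, Finset.sum_empty, pow_zero, one_mul]
      linarith
    · have := one_div_sqrt_le_of_le_abs (η := η) hr (not_le.mp h).le
      simpa [h] using this
  | succ K ih =>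
    by_cases h : |x| ≤ 2 ^ (K + 1) * r
    · have : 0 < 1 / (2 ^ (K + 1) * r) := by positivity
      rw [Finset.sum_range_succ, if_pos h]
      linarith
    · have := one_div_sqrt_le_of_le_abs (η := η) (by positivity) (not_le.mp h).le
      linarith [hsum (K + 1)]

/-- Non-accumulation in an interval centred at `E`, summed against a constant weight. -/
theorem NonAccum.sum_ite_le {N : ℕ} {δ C : ℝ} {lam : Fin N → ℝ} (h : NonAccum N δ C lam)
    (E : ℝ) {ρ c : ℝ} (hρ : (N : ℝ) ^ (-1 + δ) ≤ ρ) (hc : 0 ≤ c) :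
    ∑ i, (if |lam i - E| ≤ ρ then c else 0) ≤ C * (2 * ρ) * N * c := by
  have hρ0 : 0 ≤ ρ := le_trans (by positivity) hρ
  have hcard := h (E - ρ) (E + ρ) (by linarith) (by linarith)
  have hset : Finset.univ.filter (fun i => |lam i - E| ≤ ρ)
      = Finset.univ.filter (fun i => E - ρ ≤ lam i ∧ lam i ≤ E + ρ) := by
    ext i
    simp only [Finset.mem_filter, Finset.mem_univ, true_and, abs_le]
    constructor <;> rintro ⟨h1, h2⟩ <;> constructor <;> linarith
  rw [← Finset.sum_filter, Finset.sum_const, nsmul_eq_mul, hset]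
  refine mul_le_mul_of_nonneg_right (hcard.trans_eq ?_) hc
  ring

/-- The number of binary digits of `N` is bounded by a small power of `N`. -/
theorem natLog_two_le_rpow {N : ℕ} (hN : 2 ≤ N) {δ : ℝ} (hδ : 0 < δ) :
    (Nat.log 2 N : ℝ) ≤ (N : ℝ) ^ (2 * δ) / δ := by
  have h1 : (Nat.log 2 N : ℝ) ≤ Real.logb 2 N := by
    exact_mod_cast Real.natLog_le_logb N 2
  have h2 := Real.log_le_rpow_div (Nat.cast_nonneg N : (0 : ℝ) ≤ N) (by positivity : 0 < 2 * δ)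
  have h3 : (1 / 2 : ℝ) ≤ Real.log 2 := by linarith [Real.log_two_gt_d9]
  refine h1.trans ?_
  rw [Real.logb, div_le_iff₀ (by linarith)]
  refine h2.trans ?_
  calc (N : ℝ) ^ (2 * δ) / (2 * δ) = (N : ℝ) ^ (2 * δ) / δ * (1 / 2) := by field_simp
    _ ≤ _ := mul_le_mul_of_nonneg_left h3 (by positivity)

/-- **Dyadic resolvent-sum estimate (proof of Lemma 5.2).** Under
`(δ, C)`-non-accumulation, for every `E` and `η ≥ N^{−1−δ}`,
`∑ᵢ 1/|λᵢ − E − iη| ≤ C'·N^{1+2δ}` where `|λᵢ − E − iη| = ((λᵢ−E)² + η²)^{1/2}`,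
with `C'` depending only on `C` and `δ`. -/
theorem stmt8 (δ C : ℝ) (hδ : 0 < δ) (hC : 1 ≤ C) :
    ∃ C' : ℝ, 0 < C' ∧
      ∀ N : ℕ, 2 ≤ N →
      ∀ lam : Fin N → ℝ, NonAccum N δ C lam →
      ∀ E η : ℝ, (N : ℝ) ^ (-1 - δ) ≤ η →
        ∑ i : Fin N, 1 / Real.sqrt ((lam i - E) ^ 2 + η ^ 2)
          ≤ C' * (N : ℝ) ^ (1 + 2 * δ) := by
  refine ⟨2 * C + 4 * C * (1 / δ + 1) + 1, by positivity, ?_⟩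
  intro N hN lam hlam E η hη
  have hN0 : (0 : ℝ) < N := by positivity
  have hN1 : (1 : ℝ) ≤ N := by exact_mod_cast (by omega : 1 ≤ N)
  have hη0 : 0 < η := lt_of_lt_of_le (by positivity) hη
  set r : ℝ := (N : ℝ) ^ (-1 + δ) with hr
  have hr0 : 0 < r := by positivity
  set P : ℝ := (N : ℝ) ^ (2 * δ)
  have hP1 : 1 ≤ P := Real.one_le_rpow hN1 (by positivity)
  have hNP : (N : ℝ) ^ (1 + 2 * δ) = N * P := by
    rw [Real.rpow_add hN0, Real.rpow_one]
  set K : ℕ := Nat.log 2 N + 1 with hK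
  have hKP : (K : ℝ) ≤ (1 / δ + 1) * P := by
    have := natLog_two_le_rpow hN hδ
    rw [hK]
    push_cast
    calc (Nat.log 2 N : ℝ) + 1 ≤ P / δ + P := add_le_add this hP1
      _ = _ := by ring
  have hKr : 1 ≤ 2 ^ K * r := by
    have h1 : (N : ℝ) ≤ 2 ^ K := by
      exact_mod_cast (Nat.lt_pow_succ_log_self (by norm_num : 1 < 2) N).le
    have h2 : (N : ℝ) * r = (N : ℝ) ^ δ := by
      rw [hr, Real.rpow_add hN0, Real.rpow_neg_one, mul_inv_cancel_left₀ hN0.ne']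
    calc (1 : ℝ) ≤ (N : ℝ) ^ δ := Real.one_le_rpow hN1 hδ.le
      _ = N * r := h2.symm
      _ ≤ _ := mul_le_mul_of_nonneg_right h1 hr0.le
  have hnear : ∑ i, (if |lam i - E| ≤ r then 1 / η else 0) ≤ 2 * C * (N * P) := by
    refine (hlam.sum_ite_le E le_rfl (by positivity)).trans ?_
    have h1 : 1 / η ≤ (N : ℝ) ^ (1 + δ) := by
      calc 1 / η ≤ 1 / (N : ℝ) ^ (-1 - δ) := one_div_le_one_div_of_le (by positivity) hη
        _ = (N : ℝ) ^ (1 + δ) := by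
          rw [one_div, ← Real.rpow_neg hN0.le]
          congr 1
          ring
    have h2 : r * (N : ℝ) ^ (1 + δ) = P := by
      rw [hr, ← Real.rpow_add hN0]
      congr 1
      ring
    calc C * (2 * r) * N * (1 / η) ≤ C * (2 * r) * N * (N : ℝ) ^ (1 + δ) :=
          mul_le_mul_of_nonneg_left h1 (by positivity)
      _ = 2 * C * (N * (r * (N : ℝ) ^ (1 + δ))) := by ring
      _ = _ := by rw [h2]
  have hshell : ∀ k : ℕ, ∑ i, (if |lam i - E| ≤ 2 ^ (k + 1) * r then 1 / (2 ^ k * r) else 0)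
      ≤ 4 * C * N := by
    intro k
    have h1 : r ≤ 2 ^ (k + 1) * r :=
      le_mul_of_one_le_left hr0.le (one_le_pow₀ (by norm_num))
    refine (hlam.sum_ite_le E h1 (by positivity)).trans_eq ?_
    field_simp
    ring
  have hfar : 1 / (2 ^ K * r) ≤ 1 := by
    rw [div_le_one (by positivity)]
    exact hKr
  calc ∑ i, 1 / Real.sqrt ((lam i - E) ^ 2 + η ^ 2)
      ≤ ∑ i, ((if |lam i - E| ≤ r then 1 / η else 0)
        + ∑ k ∈ Finset.range K,
          (if |lam i - E| ≤ 2 ^ (k + 1) * r then 1 / (2 ^ k * r) else 0)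
        + 1 / (2 ^ K * r)) :=
        Finset.sum_le_sum fun i _ => one_div_sqrt_le_dyadic hη0 hr0 K
    _ = ∑ i, (if |lam i - E| ≤ r then 1 / η else 0)
        + ∑ k ∈ Finset.range K,
          ∑ i, (if |lam i - E| ≤ 2 ^ (k + 1) * r then 1 / (2 ^ k * r) else 0)
        + N * (1 / (2 ^ K * r)) := by
        rw [Finset.sum_add_distrib, Finset.sum_add_distrib, Finset.sum_comm]
        simp
    _ ≤ 2 * C * (N * P) + K * (4 * C * N) + N * 1 := by
        refine add_le_add (add_le_add hnear ?_) (mul_le_mul_of_nonneg_left hfar hN0.le)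
        refine (Finset.sum_le_sum fun k _ => hshell k).trans_eq ?_
        simp
    _ ≤ 2 * C * (N * P) + (1 / δ + 1) * P * (4 * C * N) + N * P := by
        gcongr
    _ = (2 * C + 4 * C * (1 / δ + 1) + 1) * (N : ℝ) ^ (1 + 2 * δ) := by
        rw [hNP]
        ring
end
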